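/- Let d ≥ 3 be an integer and let a ∈ ℤ^d satisfy gcd(a_1, …, a_d) = 1, a_i ≥ 2 for all i, and a_i ≤ a_d for i = 1, …, d−1. Let L_a ⊆ ℝ^{d−1} be the set of vectors (w_1, …, w_{d−1}) such that (w_1, …, w_{d−1}, 0) belongs to the lattice m(â)·D(a_d)·n(â)·ℤ^d, i.e. L_a is the intersection of the unimodular lattice m(â)D(a_d)n(â)ℤ^d ⊆ ℝ^d with the hyperplane {x ∈ ℝ^d : x_d = 0}, identified with ℝ^{d−1} via the first d−1 coordinates. Then L_a is a unimodular lattice in ℝ^{d−1} and (F(a) + Σ_{i=1}^d a_i) / (a_1⋯a_d)^{1/(d−1)} = Q(Δ_{d−1}, L_a). -/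

import Mathlib

noncomputable section

open MeasureTheory Matrix Pointwise

/-- `SL_n(ℝ)` -/
abbrev SLR (n : ℕ) := Matrix.SpecialLinearGroup (Fin n) ℝ

instance (n : ℕ) : TopologicalSpace (SLR n) :=
  TopologicalSpace.induced (fun g => (g : Matrix (Fin n) (Fin n) ℝ)) inferInstance

/-- `SL_n(ℤ)` viewed as a subgroup of `SL_n(ℝ)`. -/
def SLZsub (n : ℕ) : Subgroup (SLR n) :=
  (Matrix.SpecialLinearGroup.map (n := Fin n) (Int.castRingHom ℝ)).range

/-- The space of unimodular lattices `X = SL_n(ℝ)/SL_n(ℤ)`. -/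
abbrev XQuot (n : ℕ) := SLR n ⧸ SLZsub n

instance (n : ℕ) : MeasurableSpace (XQuot n) := borel _

/-- The lattice `M·ℤ^n` associated to a matrix `M`. -/
def matLattice {n : ℕ} (M : Matrix (Fin n) (Fin n) ℝ) : Set (Fin n → ℝ) :=
  {x | ∃ v : Fin n → ℤ, x = M.mulVec fun i => (v i : ℝ)}

/-- The covering radius `Q(K, L) = inf{t > 0 : tK + L = ℝ^n}`. -/
def covRad (n : ℕ) (K L : Set (Fin n → ℝ)) : ℝ :=
  sInf {t : ℝ | 0 < t ∧ ∀ x : Fin n → ℝ, ∃ k ∈ K, ∃ l ∈ L, x = t • k + l}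

/-- The standard simplex `Δ_n = {x : x_i ≥ 0, ∑ x_i ≤ 1}`. -/
def simplexStd (n : ℕ) : Set (Fin n → ℝ) :=
  {x | (∀ i, 0 ≤ x i) ∧ ∑ i, x i ≤ 1}

/-- The unimodular lattice `g·ℤ^n` of `g ∈ SL_n(ℝ)`. -/
def latticeOf {n : ℕ} (g : SLR n) : Set (Fin n → ℝ) :=
  matLattice (g : Matrix (Fin n) (Fin n) ℝ)

/-- The set of natural numbers not representable as a nonnegative integer
combination of the coordinates of `a`. -/
def nonRepresentable (d : ℕ) (a : Fin d → ℤ) : Set ℕ :=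
  {m : ℕ | ¬ ∃ k : Fin d → ℕ, (m : ℤ) = ∑ i, (k i : ℤ) * a i}

/-- The Frobenius number `F(a)`: the largest natural number not representable
as a nonnegative integer combination of the coordinates of `a`. -/
def frobNum (d : ℕ) (a : Fin d → ℤ) : ℕ := sSup (nonRepresentable d a)

/-- `ζ(d) = ∑_{n ≥ 1} n^{-d}`. -/
def zetaVal (d : ℕ) : ℝ := ∑' k : ℕ, 1 / ((k : ℝ) + 1) ^ d

/-- `â = (a_1/a_d, …, a_{d-1}/a_d)` for `a ∈ ℤ^d`, `d = e + 1`. -/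
def aHat (e : ℕ) (a : Fin (e + 1) → ℤ) : Fin e → ℝ :=
  fun i => (a i.castSucc : ℝ) / (a (Fin.last e) : ℝ)

/-- `D(s) = diag(s^{-1/(d-1)}, …, s^{-1/(d-1)}, s)`, `d = e + 1`. -/
def dMat (e : ℕ) (s : ℝ) : Matrix (Fin (e + 1)) (Fin (e + 1)) ℝ :=
  Matrix.diagonal fun i => if i = Fin.last e then s else s ^ (-(1 / (e : ℝ)))

/-- `n(x)`: the identity matrix except that the last row is `(x_1, …, x_{d-1}, 1)`. -/
def nMat (e : ℕ) (x : Fin e → ℝ) : Matrix (Fin (e + 1)) (Fin (e + 1)) ℝ :=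
  Matrix.of fun i j =>
    if i = Fin.last e then
      (if hj : j = Fin.last e then 1 else x (j.castPred hj))
    else (if i = j then 1 else 0)

/-- `m(y) = diag(m'(y), 1)` where `m'(y) = (y_1⋯y_{d-1})^{-1/(d-1)}·diag(y)`. -/
def mMat (e : ℕ) (y : Fin e → ℝ) : Matrix (Fin (e + 1)) (Fin (e + 1)) ℝ :=
  Matrix.diagonal fun i =>
    if hi : i = Fin.last e then 1
    else (∏ j, y j) ^ (-(1 / (e : ℝ))) * y (i.castPred hi)

/-- `k(A, b)`: the block matrix with upper-left block `A`, upper-right column `b`,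
lower-left row `0` and lower-right entry `1`. -/
def kMat (e : ℕ) (A : Matrix (Fin e) (Fin e) ℝ) (b : Fin e → ℝ) :
    Matrix (Fin (e + 1)) (Fin (e + 1)) ℝ :=
  Matrix.of fun i j =>
    if hi : i = Fin.last e then (if j = Fin.last e then 1 else 0)
    else (if hj : j = Fin.last e then b (i.castPred hi)
          else A (i.castPred hi) (j.castPred hj))

theorem exists_matrix_of_submodule_index_ne_zero {e : ℕ} (N : Submodule ℤ (Fin e → ℤ))
    (hN : N.toAddSubgroup.index ≠ 0) :
    ∃ C : Matrix (Fin e) (Fin e) ℤ, C.det.natAbs = N.toAddSubgroup.index ∧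
      ∀ v, v ∈ N ↔ ∃ c, v = C.mulVec c := by
  obtain ⟨f⟩ := Int.submodule_toAddSubgroup_index_ne_zero_iff.1 hN
  let b : Module.Basis (Fin e) ℤ N := .ofEquivFun f
  refine ⟨(Matrix.of fun i => (b i : Fin e → ℤ))ᵀ, ?_, fun v => ?_⟩
  · refine Eq.trans ?_ (Submodule.natAbs_det_basis_change (Pi.basisFun ℤ (Fin e)) N b)
    rw [Module.Basis.det_apply]
    congr 2
  · rw [b.mem_submodule_iff']
    refine exists_congr fun c => ?_
    have h : ∑ i, c i • (b i : Fin e → ℤ) =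
        (Matrix.of fun i => (b i : Fin e → ℤ))ᵀ.mulVec c := by
      ext j
      simp [Matrix.mulVec, dotProduct, mul_comm]
    rw [h]

/-- The scaling factor `(a_1⋯a_d)^{-1/(d-1)}`. -/
def latticeScale (e : ℕ) (a : Fin (e + 1) → ℤ) : ℝ :=
  (∏ i, (a i : ℝ)) ^ (-(1 / (e : ℝ)))

theorem snoc_zero_mem_iff {e : ℕ} (he : 0 < e) {a : Fin (e + 1) → ℤ} (ha : ∀ i, 0 < a i)
    (w : Fin e → ℝ) :
    Fin.snoc w (0 : ℝ) ∈
        matLattice (mMat e (aHat e a) * dMat e (a (Fin.last e) : ℝ) * nMat e (aHat e a)) ↔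
      ∃ v : Fin e → ℤ, a (Fin.last e) ∣ ∑ i, a i.castSucc * v i ∧
        w = fun i => latticeScale e a * (a i.castSucc : ℝ) * (v i : ℝ) := by
  have ha' : ∀ i, 0 < (a i : ℝ) := fun i => Int.cast_pos.2 (ha i)
  have hN := ha' (Fin.last e)
  have he' : (e : ℝ) ≠ 0 := by positivity
  have hcoef : ∀ i : Fin e, (∏ j, aHat e a j) ^ (-(1 / (e : ℝ))) * aHat e a i *
      (a (Fin.last e) : ℝ) ^ (-(1 / (e : ℝ))) = latticeScale e a * (a i.castSucc : ℝ) := by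
    intro i
    have hp : 0 < ∏ j : Fin e, (a j.castSucc : ℝ) := Finset.prod_pos fun j _ => ha' _
    have hpow : ((a (Fin.last e) : ℝ) ^ e) ^ (-(1 / (e : ℝ))) = (a (Fin.last e) : ℝ)⁻¹ := by
      rw [← Real.rpow_natCast, ← Real.rpow_mul hN.le]
      rw [show (e : ℝ) * -(1 / (e : ℝ)) = -1 by field_simp, Real.rpow_neg_one]
    simp only [aHat, latticeScale, Finset.prod_div_distrib, Finset.prod_const, Finset.card_univ,
      Fintype.card_fin, Fin.prod_univ_castSucc]
    rw [Real.div_rpow hp.le (by positivity), Real.mul_rpow hp.le hN.le, hpow]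
    field_simp
  have hrow : ∀ (x : Fin (e + 1) → ℝ) (i : Fin e),
      (mMat e (aHat e a) * dMat e (a (Fin.last e) : ℝ) * nMat e (aHat e a)).mulVec x i.castSucc =
        latticeScale e a * (a i.castSucc : ℝ) * x i.castSucc := by
    intro x i
    rw [mMat, dMat, Matrix.diagonal_mul_diagonal, ← Matrix.mulVec_mulVec,
      Matrix.mulVec_diagonal, ← hcoef]
    simp [nMat, Matrix.mulVec, dotProduct, (Fin.castSucc_lt_last i).ne]
  have hlast : ∀ (x : Fin (e + 1) → ℝ),
      (mMat e (aHat e a) * dMat e (a (Fin.last e) : ℝ) * nMat e (aHat e a)).mulVec x (Fin.last e) =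
        ∑ i : Fin (e + 1), (a i : ℝ) * x i := by
    intro x
    rw [mMat, dMat, Matrix.diagonal_mul_diagonal, ← Matrix.mulVec_mulVec,
      Matrix.mulVec_diagonal]
    simp only [nMat, Matrix.mulVec, dotProduct, Fin.sum_univ_castSucc]
    simp only [↓reduceDIte, one_mul, of_apply, ↓reduceIte, (Fin.castSucc_lt_last _).ne,
      Fin.castPred_castSucc, aHat, mul_add, Finset.mul_sum]
    congr 1
    refine Finset.sum_congr rfl fun i _ => ?_
    field_simp
  constructor
  · rintro ⟨v, hv⟩
    refine ⟨fun i => v i.castSucc, ?_, ?_⟩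
    · have h := congrFun hv (Fin.last e)
      rw [hlast, Fin.snoc_last, Fin.sum_univ_castSucc] at h
      refine ⟨-v (Fin.last e), ?_⟩
      have h' : (0 : ℤ) = ∑ i : Fin e, a i.castSucc * v i.castSucc +
          a (Fin.last e) * v (Fin.last e) := by exact_mod_cast h
      linarith
    · funext i
      have h := congrFun hv i.castSucc
      rwa [hrow, Fin.snoc_castSucc] at h
  · rintro ⟨v, ⟨q, hq⟩, rfl⟩
    refine ⟨Fin.snoc v (-q), ?_⟩
    funext i
    refine Fin.lastCases ?_ (fun i => ?_) i
    · rw [hlast, Fin.snoc_last, Fin.sum_univ_castSucc]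
      simp only [Fin.snoc_castSucc, Fin.snoc_last]
      have h : (∑ i : Fin e, (a i.castSucc : ℝ) * (v i : ℝ)) = a (Fin.last e) * q := by
        exact_mod_cast hq
      rw [h]
      push_cast
      ring
    · rw [hrow]
      simp only [Fin.snoc_castSucc]

theorem exists_sum_mul_eq_one {ι : Type*} [Fintype ι] {a : ι → ℤ}
    (hgcd : Finset.univ.gcd a = 1) : ∃ g : ι → ℤ, ∑ i, a i * g i = 1 := by
  obtain ⟨g, hg⟩ := Finset.gcd_eq_sum_mul Finset.univ a
  exact ⟨g, by rw [← hg, hgcd]⟩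

theorem exists_unimodular_basis {e : ℕ} (he : 0 < e) {a : Fin (e + 1) → ℤ}
    (hgcd : Finset.univ.gcd a = 1) (ha : ∀ i, 0 < a i) :
    ∃ B : Matrix (Fin e) (Fin e) ℝ, |B.det| = 1 ∧
      {w : Fin e → ℝ | Fin.snoc w (0 : ℝ) ∈
        matLattice (mMat e (aHat e a) * dMat e (a (Fin.last e) : ℝ) * nMat e (aHat e a))}
        = matLattice B := by
  have ha' : ∀ i, 0 < (a i : ℝ) := fun i => Int.cast_pos.2 (ha i)
  have he' : (e : ℝ) ≠ 0 := by positivity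
  obtain ⟨n, hn⟩ : ∃ n : ℕ, a (Fin.last e) = n := ⟨_, (Int.toNat_of_nonneg (ha _).le).symm⟩
  have hn0 : n ≠ 0 := by have := ha (Fin.last e); omega
  have : NeZero n := ⟨hn0⟩
  let s : (Fin e → ℤ) →ₗ[ℤ] ℤ := ∑ i, a i.castSucc • LinearMap.proj i
  have hs : ∀ v, s v = ∑ i, a i.castSucc * v i := fun v => by simp [s]
  let φ : (Fin e → ℤ) →+ ZMod n := (Int.castAddHom (ZMod n)).comp s.toAddMonoidHom
  have hφ : ∀ v, φ v = ((∑ i, a i.castSucc * v i : ℤ) : ZMod n) := fun v => by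
    simp [φ, ← hs]
  have hsurj : Function.Surjective φ := by
    intro x
    obtain ⟨g, hg⟩ := exists_sum_mul_eq_one hgcd
    obtain ⟨m, rfl⟩ := ZMod.intCast_surjective x
    refine ⟨fun i => m * g i.castSucc, ?_⟩
    rw [hφ, ZMod.intCast_eq_intCast_iff_dvd_sub, ← hn]
    rw [Fin.sum_univ_castSucc] at hg
    refine ⟨m * g (Fin.last e), ?_⟩
    simp only [mul_left_comm _ m, ← Finset.mul_sum]
    linear_combination -m * hg
  have hmem : ∀ v, v ∈ AddSubgroup.toIntSubmodule φ.ker ↔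
      a (Fin.last e) ∣ ∑ i, a i.castSucc * v i := fun v => by
    change φ v = 0 ↔ _
    rw [hφ, ZMod.intCast_zmod_eq_zero_iff_dvd, hn]
  have hidx : (AddSubgroup.toIntSubmodule φ.ker).toAddSubgroup.index = n := by
    change φ.ker.index = n
    rw [AddSubgroup.index_ker, AddMonoidHom.range_eq_top.2 hsurj]
    simp
  obtain ⟨C, hC, hCmem⟩ := exists_matrix_of_submodule_index_ne_zero
    (AddSubgroup.toIntSubmodule φ.ker) (by rw [hidx]; exact hn0)
  refine ⟨Matrix.diagonal (fun i : Fin e => latticeScale e a * (a i.castSucc : ℝ)) *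
    C.map (Int.cast : ℤ → ℝ), ?_, ?_⟩
  · have hdet : |(C.map (Int.cast : ℤ → ℝ)).det| = a (Fin.last e) := by
      have h : (C.map (Int.cast : ℤ → ℝ)).det = (C.det : ℝ) := by
        exact ((Int.castRingHom ℝ).map_det C).symm
      rw [h, hn, ← hidx, ← hC]
      simp
    have hP : 0 < ∏ i, (a i : ℝ) := Finset.prod_pos fun i _ => ha' i
    have hscale : latticeScale e a ^ e * ∏ i, (a i : ℝ) = 1 := by
      rw [latticeScale, ← Real.rpow_natCast, ← Real.rpow_mul hP.le]
      rw [show -(1 / (e : ℝ)) * e = -1 by field_simp, Real.rpow_neg_one, inv_mul_cancel₀ hP.ne']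
    rw [Matrix.det_mul, abs_mul, hdet, Matrix.det_diagonal, Finset.prod_mul_distrib,
      Finset.prod_const, Finset.card_univ, Fintype.card_fin, abs_of_nonneg, mul_assoc,
      ← Fin.prod_univ_castSucc (fun i => (a i : ℝ)), hscale]
    have : 0 < latticeScale e a := Real.rpow_pos_of_pos hP _
    have : 0 < ∏ i : Fin e, (a i.castSucc : ℝ) := Finset.prod_pos fun i _ => ha' _
    positivity
  · have hcast : ∀ (c : Fin e → ℤ) (i : Fin e),
        (C.map (Int.cast : ℤ → ℝ)).mulVec (fun i => (c i : ℝ)) i = (C.mulVec c i : ℝ) := by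
      intro c i
      simp [Matrix.mulVec, dotProduct]
    ext w
    rw [Set.mem_ofPred_eq, snoc_zero_mem_iff he ha, matLattice, Set.mem_ofPred_eq]
    simp only [← hmem, hCmem, ← Matrix.mulVec_mulVec]
    constructor
    · rintro ⟨v, ⟨c, rfl⟩, rfl⟩
      refine ⟨c, ?_⟩
      ext i
      rw [Matrix.mulVec_diagonal, hcast]
    · rintro ⟨c, rfl⟩
      refine ⟨C.mulVec c, ⟨c, rfl⟩, ?_⟩
      ext i
      rw [Matrix.mulVec_diagonal, hcast]

theorem mem_nonRepresentable_iff {d : ℕ} {a : Fin d → ℤ} {m : ℕ} :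
    m ∈ nonRepresentable d a ↔ ¬ ∃ k : Fin d → ℕ, (m : ℤ) = ∑ i, (k i : ℤ) * a i :=
  Iff.rfl

theorem bddAbove_nonRepresentable {e : ℕ} {a : Fin (e + 1) → ℤ}
    (hgcd : Finset.univ.gcd a = 1) (ha : ∀ i, 0 < a i) :
    BddAbove (nonRepresentable (e + 1) a) := by
  obtain ⟨g, hg⟩ := exists_sum_mul_eq_one hgcd
  have hN := ha (Fin.last e)
  refine ⟨(a (Fin.last e) * ∑ i : Fin e, a i.castSucc).toNat, fun m hm => ?_⟩
  by_contra! hlt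
  have hlt' := (Int.toNat_lt_of_ne_zero (by omega)).1 hlt
  refine hm ?_
  set N := a (Fin.last e)
  set r : Fin e → ℤ := fun i => (m * g i.castSucc) % N
  set q : ℤ := m * g (Fin.last e) + ∑ i : Fin e, a i.castSucc * ((m * g i.castSucc) / N)
  have hr : ∀ i, 0 ≤ r i := fun i => Int.emod_nonneg _ hN.ne'
  have hsum : (m : ℤ) = ∑ i : Fin e, r i * a i.castSucc + q * N := by
    have h1 : ∀ i : Fin e, r i * a i.castSucc + a i.castSucc * ((m * g i.castSucc) / N) * N =
        m * (a i.castSucc * g i.castSucc) := by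
      intro i
      have := Int.emod_add_mul_ediv (m * g i.castSucc) N
      simp only [r]
      linear_combination a i.castSucc * this
    have h2 := Finset.sum_congr rfl fun i (_ : i ∈ Finset.univ) => h1 i
    rw [Finset.sum_add_distrib, ← Finset.mul_sum, ← Finset.sum_mul] at h2
    rw [Fin.sum_univ_castSucc] at hg
    simp only [q]
    linear_combination -m * hg - h2
  have hq : 0 ≤ q := by
    have hle : ∑ i : Fin e, r i * a i.castSucc ≤ N * ∑ i : Fin e, a i.castSucc := by
      rw [Finset.mul_sum]
      exact Finset.sum_le_sum fun i _ =>
        mul_le_mul_of_nonneg_right (Int.emod_lt_of_pos _ hN).le (ha _).le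
    by_contra! hneg
    nlinarith
  refine ⟨Fin.snoc (fun i => (r i).toNat) q.toNat, ?_⟩
  rw [Fin.sum_univ_castSucc]
  simp only [Fin.snoc_castSucc, Fin.snoc_last, Int.toNat_of_nonneg hq, Int.toNat_of_nonneg (hr _)]
  exact hsum

theorem frobNum_mem {e : ℕ} {a : Fin (e + 1) → ℤ}
    (hgcd : Finset.univ.gcd a = 1) (h2 : ∀ i, 2 ≤ a i) :
    frobNum (e + 1) a ∈ nonRepresentable (e + 1) a := by
  refine Nat.sSup_mem ⟨1, ?_⟩
    (bddAbove_nonRepresentable hgcd fun i => lt_of_lt_of_le two_pos (h2 i))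
  rintro ⟨k, hk⟩
  by_cases h0 : ∀ i, k i = 0
  · simp [h0] at hk
  · push Not at h0
    obtain ⟨i, hi⟩ := h0
    have h1 : (k i : ℤ) * a i ≤ ∑ i, (k i : ℤ) * a i :=
      Finset.single_le_sum (f := fun i => (k i : ℤ) * a i)
        (fun j _ => mul_nonneg (Nat.cast_nonneg _) (by linarith [h2 j])) (Finset.mem_univ i)
    have h3 : 1 ≤ (k i : ℤ) := by omega
    have := h2 i
    push_cast at hk
    nlinarith

theorem exists_sum_modEq_le {e : ℕ} {a : Fin (e + 1) → ℤ}
    (hgcd : Finset.univ.gcd a = 1) (ha : ∀ i, 0 < a i) (A : ℤ) :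
    ∃ u : Fin e → ℕ, a (Fin.last e) ∣ A - ∑ i, a i.castSucc * u i ∧
      ∑ i, a i.castSucc * u i ≤ frobNum (e + 1) a + a (Fin.last e) := by
  set F := frobNum (e + 1) a
  have hN := ha (Fin.last e)
  set N := a (Fin.last e)
  have hnn := Int.emod_nonneg (A - F - 1) hN.ne'
  have hlt := Int.emod_lt_of_pos (A - F - 1) hN
  have hdiv := Int.emod_add_mul_ediv (A - F - 1) N
  set ρ := (A - F - 1) % N
  have hm : F + 1 + ρ.toNat ∉ nonRepresentable (e + 1) a := fun h => by
    have := le_csSup (bddAbove_nonRepresentable hgcd ha) h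
    change _ ≤ F at this
    omega
  rw [mem_nonRepresentable_iff, not_not] at hm
  obtain ⟨k, hk⟩ := hm
  rw [Fin.sum_univ_castSucc] at hk
  push_cast at hk
  rw [Int.toNat_of_nonneg hnn] at hk
  refine ⟨fun i => k i.castSucc, ?_, ?_⟩
  · refine ⟨(A - F - 1) / N + k (Fin.last e), ?_⟩
    simp only [mul_comm (a _) (k _ : ℤ)]
    linear_combination -hdiv + hk
  · simp only [mul_comm (a _) (k _ : ℤ)]
    have : 0 ≤ (k (Fin.last e) : ℤ) * N := by positivity
    linarith

theorem frobNum_add_le_sum {e : ℕ} {a : Fin (e + 1) → ℤ}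
    (hgcd : Finset.univ.gcd a = 1) (h2 : ∀ i, 2 ≤ a i) (u : Fin e → ℤ) (hu : ∀ i, 0 ≤ u i)
    (hdvd : a (Fin.last e) ∣ ∑ i, a i.castSucc * u i - frobNum (e + 1) a) :
    (frobNum (e + 1) a : ℤ) + a (Fin.last e) ≤ ∑ i, a i.castSucc * u i := by
  obtain ⟨j, hj⟩ := hdvd
  have hN := h2 (Fin.last e)
  rcases le_or_gt j 0 with h | h
  · refine absurd ?_ (frobNum_mem hgcd h2)
    refine ⟨Fin.snoc (fun i => (u i).toNat) (-j).toNat, ?_⟩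
    rw [Fin.sum_univ_castSucc]
    simp only [Fin.snoc_castSucc, Fin.snoc_last, Int.toNat_of_nonneg (hu _),
      Int.toNat_of_nonneg (neg_nonneg.2 h), mul_comm (u _)]
    linear_combination -hj
  · nlinarith

/-- `t` dilates the standard simplex to a covering body for the lattice `L_a` iff `t` is at least
`(F(a) + ∑ a_i) / (a_1⋯a_d)^{1/(d-1)}`. -/
theorem covers_iff {e : ℕ} (he : 0 < e) {a : Fin (e + 1) → ℤ}
    (hgcd : Finset.univ.gcd a = 1) (h2 : ∀ i, 2 ≤ a i) {t : ℝ} (ht : 0 < t) :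
    (∀ x : Fin e → ℝ, ∃ k ∈ simplexStd e, ∃ l ∈ {w : Fin e → ℝ | Fin.snoc w (0 : ℝ) ∈
        matLattice (mMat e (aHat e a) * dMat e (a (Fin.last e) : ℝ) * nMat e (aHat e a))},
        x = t • k + l) ↔
      latticeScale e a * (frobNum (e + 1) a + ∑ i, (a i : ℝ)) ≤ t := by
  have ha : ∀ i, 0 < a i := fun i => lt_of_lt_of_le two_pos (h2 i)
  have ha' : ∀ i, 0 < (a i : ℝ) := fun i => Int.cast_pos.2 (ha i)
  have hr : 0 < latticeScale e a := Real.rpow_pos_of_pos (Finset.prod_pos fun i _ => ha' i) _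
  set r := latticeScale e a
  simp only [Set.mem_ofPred_eq, snoc_zero_mem_iff he ha]
  constructor
  · intro h
    obtain ⟨g, hg⟩ := exists_sum_mul_eq_one hgcd
    rw [Fin.sum_univ_castSucc] at hg
    set F := frobNum (e + 1) a with hF
    set z : Fin e → ℤ := fun i => F * g i.castSucc
    have hz : ∑ i, a i.castSucc * z i = F - F * g (Fin.last e) * a (Fin.last e) := by
      simp only [z, mul_left_comm _ (F : ℤ), ← Finset.mul_sum]
      linear_combination F * hg
    have key : ∀ ε : ℝ, 0 < ε →
        r * (F + ∑ i, (a i : ℝ)) ≤ t + ε * (r * ∑ i : Fin e, (a i.castSucc : ℝ)) := by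
      intro ε hε
      obtain ⟨k, ⟨hk0, hk1⟩, l, ⟨v, hv, rfl⟩, hx⟩ :=
        h fun i => r * a i.castSucc * (z i + 1 - ε)
      have hx' : ∀ i, t * k i = r * a i.castSucc * (z i + 1 - ε - v i) := fun i => by
        have := congrFun hx i
        simp only [Pi.add_apply, Pi.smul_apply, smul_eq_mul] at this
        linear_combination -this
      have hvz : ∀ i, v i ≤ z i := fun i => by
        have h0 : 0 ≤ r * a i.castSucc * (z i + 1 - ε - v i) := by
          rw [← hx' i]
          exact mul_nonneg ht.le (hk0 i)
        have h1 := nonneg_of_mul_nonneg_right h0 (mul_pos hr (ha' i.castSucc))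
        have h3 : (v i : ℝ) < z i + 1 := by linarith
        exact Int.lt_add_one_iff.1 (by exact_mod_cast h3)
      have hsum := frobNum_add_le_sum hgcd h2 (fun i => z i - v i)
        (fun i => sub_nonneg.2 (hvz i)) (by
          obtain ⟨q, hq⟩ := hv
          refine ⟨-F * g (Fin.last e) - q, ?_⟩
          simp only [mul_sub, Finset.sum_sub_distrib, hz, hq]
          ring)
      have hsum' : (F : ℝ) + a (Fin.last e) ≤ ∑ i : Fin e, (a i.castSucc : ℝ) * (z i - v i) := by
        exact_mod_cast hsum
      have htk : ∑ i, t * k i ≤ t := by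
        rw [← Finset.mul_sum]
        exact mul_le_of_le_one_right ht.le hk1
      have heq : ∑ i, t * k i = r * (∑ i : Fin e, (a i.castSucc : ℝ) * (z i - v i) +
          (1 - ε) * ∑ i : Fin e, (a i.castSucc : ℝ)) := by
        rw [Finset.mul_sum, ← Finset.sum_add_distrib, Finset.mul_sum]
        exact Finset.sum_congr rfl fun i _ => by rw [hx' i]; ring
      rw [Fin.sum_univ_castSucc]
      have := mul_le_mul_of_nonneg_left hsum' hr.le
      linarith
    have hc : 0 < r * ∑ i : Fin e, (a i.castSucc : ℝ) := by
      have : Nonempty (Fin e) := ⟨⟨0, he⟩⟩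
      exact mul_pos hr (Finset.sum_pos (fun i _ => ha' _) Finset.univ_nonempty)
    refine le_of_forall_pos_le_add fun δ hδ => ?_
    have := key _ (div_pos hδ hc)
    rwa [div_mul_cancel₀ _ hc.ne'] at this
  · intro h x
    set y : Fin e → ℝ := fun i => x i / (r * a i.castSucc)
    obtain ⟨u, hu, hle⟩ := exists_sum_modEq_le hgcd ha (∑ i, a i.castSucc * ⌊y i⌋)
    have hxy : ∀ i, x i = r * a i.castSucc * y i := fun i =>
      (mul_div_cancel₀ _ (mul_pos hr (ha' _)).ne').symm
    have hfl : ∀ i, (⌊y i⌋ : ℝ) ≤ y i := fun i => Int.floor_le _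
    refine ⟨fun i => r * a i.castSucc * (y i - (⌊y i⌋ - u i)) / t, ⟨fun i => ?_, ?_⟩, _,
      ⟨fun i => ⌊y i⌋ - u i, ?_, rfl⟩, ?_⟩
    · have := hfl i
      have := ha' i.castSucc
      have : (0 : ℝ) ≤ y i - (⌊y i⌋ - u i) := by
        have : (0 : ℝ) ≤ u i := Nat.cast_nonneg _
        linarith
      positivity
    · rw [← Finset.sum_div, div_le_one ht]
      refine le_trans ?_ h
      simp only [mul_assoc]
      rw [← Finset.mul_sum, Fin.sum_univ_castSucc]
      refine mul_le_mul_of_nonneg_left ?_ hr.le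
      have hle' : (∑ i : Fin e, (a i.castSucc : ℝ) * u i) ≤
          frobNum (e + 1) a + a (Fin.last e) := by exact_mod_cast hle
      have hb : ∑ i : Fin e, (a i.castSucc : ℝ) * (y i - (⌊y i⌋ - u i)) ≤
          ∑ i : Fin e, ((a i.castSucc : ℝ) + a i.castSucc * u i) :=
        Finset.sum_le_sum fun i _ => by
          have := Int.lt_floor_add_one (y i)
          have := ha' i.castSucc
          nlinarith
      rw [Finset.sum_add_distrib] at hb
      linarith
    · simpa only [mul_sub, Finset.sum_sub_distrib] using hu
    · ext i
      simp only [Pi.add_apply, Pi.smul_apply, smul_eq_mul]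
      rw [mul_div_cancel₀ _ ht.ne']
      push_cast
      linear_combination hxy i

/-- Explicit description of the lattice producing the Frobenius number:
`L_a = m(â)D(a_d)n(â)ℤ^d ∩ e_d^⊥` is a unimodular lattice in `ℝ^{d-1}` and
`(F(a) + ∑ a_i)/(a_1⋯a_d)^{1/(d-1)} = Q(Δ_{d-1}, L_a)`.  Here `e = d - 1 ≥ 2`. -/
theorem frobenius_via_La (e : ℕ) (he : 2 ≤ e) (a : Fin (e + 1) → ℤ)
    (hgcd : Finset.univ.gcd a = 1) (h2 : ∀ i, 2 ≤ a i)
    (hle : ∀ i : Fin e, a i.castSucc ≤ a (Fin.last e)) :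
    (∃ B : Matrix (Fin e) (Fin e) ℝ, |B.det| = 1 ∧
        {w : Fin e → ℝ | Fin.snoc w (0 : ℝ) ∈
            matLattice (mMat e (aHat e a) * dMat e (a (Fin.last e) : ℝ) * nMat e (aHat e a))}
          = matLattice B) ∧
    ((frobNum (e + 1) a : ℝ) + ∑ i, (a i : ℝ)) / (∏ i, (a i : ℝ)) ^ (1 / (e : ℝ))
      = covRad e (simplexStd e)
          {w : Fin e → ℝ | Fin.snoc w (0 : ℝ) ∈
            matLattice
              (mMat e (aHat e a) * dMat e (a (Fin.last e) : ℝ) * nMat e (aHat e a))} := by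
  have ha : ∀ i, 0 < a i := fun i => lt_of_lt_of_le two_pos (h2 i)
  have ha' : ∀ i, 0 < (a i : ℝ) := fun i => Int.cast_pos.2 (ha i)
  have hP : 0 < ∏ i, (a i : ℝ) := Finset.prod_pos fun i _ => ha' i
  have he' : 0 < e := by omega
  refine ⟨exists_unimodular_basis he' hgcd ha, ?_⟩
  have hT : ((frobNum (e + 1) a : ℝ) + ∑ i, (a i : ℝ)) / (∏ i, (a i : ℝ)) ^ (1 / (e : ℝ)) =
      latticeScale e a * (frobNum (e + 1) a + ∑ i, (a i : ℝ)) := by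
    rw [latticeScale, Real.rpow_neg hP.le, div_eq_inv_mul]
  have hpos : 0 < latticeScale e a * (frobNum (e + 1) a + ∑ i, (a i : ℝ)) :=
    mul_pos (Real.rpow_pos_of_pos hP _) (add_pos_of_nonneg_of_pos (Nat.cast_nonneg _)
      (Finset.sum_pos (fun i _ => ha' i) Finset.univ_nonempty))
  rw [hT, covRad]
  refine csInf_Ici.symm.trans (congrArg sInf ?_)
  ext t
  exact ⟨fun h => ⟨hpos.trans_le h, (covers_iff he' hgcd h2 (hpos.trans_le h)).2 h⟩,
    fun ⟨ht, h⟩ => (covers_iff he' hgcd h2 ht).1 h⟩
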